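/- arXiv:2302.00175 — 3 statements merged into one kernel-verified Lean document; each statement's English description precedes it below -/
import Mathlib

section
/- Let n ≥ 3 be an integer, let τ > (n−2)/2, and let g be a C² metric on ℝ^n_+ that is C²-asymptotically flat of rate τ. Let η : ℝ → ℝ be smooth with η(s) = 0 for s ≥ 1/2, and let f be the associated barrier function. Then: (i) there exists λ₀ > 1 such that f(x) < 0 and Δ_g f(x) < 0 for all x ∈ ℝ^n_+ with |x| > λ₀; (ii) for every y ∈ ∂ℝ^n_+ with |y| > 1 one has ∂_n f(y) = η'(0)·|y|^{1−n−τ}; (iii) if η'(0) < 0, then λ₀ in (i) can be chosen so that in addition D_{ν_g}f(y) < 0 for all y ∈ ∂ℝ^n_+ with |y| > λ₀. -/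
open MeasureTheory Real Filter Topology Finset

noncomputable section

/-- Partial derivative of `f` in the `i`-th coordinate direction. -/
def pd {n : ℕ} (i : Fin n) (f : EuclideanSpace ℝ (Fin n) → ℝ)
    (x : EuclideanSpace ℝ (Fin n)) : ℝ :=
  fderiv ℝ f x (EuclideanSpace.single i 1)

/-- The closed upper half-space `{x : x iN ≥ 0}`. -/
def halfSpace {n : ℕ} (iN : Fin n) : Set (EuclideanSpace ℝ (Fin n)) :=
  {x | 0 ≤ x iN}

/-- The boundary hyperplane `{x : x iN = 0}`. -/
def bdry {n : ℕ} (iN : Fin n) : Set (EuclideanSpace ℝ (Fin n)) :=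
  {x | x iN = 0}

/-- Christoffel symbols `Γ^k_{ij}` of a metric `g`. -/
def christoffel {n : ℕ} (g : EuclideanSpace ℝ (Fin n) → Matrix (Fin n) (Fin n) ℝ)
    (k i j : Fin n) (x : EuclideanSpace ℝ (Fin n)) : ℝ :=
  (1 / 2) * ∑ l, (g x)⁻¹ k l *
    (pd i (fun y => g y j l) x + pd j (fun y => g y i l) x - pd l (fun y => g y i j) x)

/-- The Laplace–Beltrami operator of the metric `g`. -/
def laplaceBeltrami {n : ℕ} (g : EuclideanSpace ℝ (Fin n) → Matrix (Fin n) (Fin n) ℝ)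
    (u : EuclideanSpace ℝ (Fin n) → ℝ) (x : EuclideanSpace ℝ (Fin n)) : ℝ :=
  ∑ i, ∑ j, (g x)⁻¹ i j *
    (pd i (pd j u) x - ∑ k, christoffel g k i j x * pd k u x)

/-- The inward-pointing `g`-unit normal to the boundary hyperplane, as a vector. -/
def nuVec {n : ℕ} (iN : Fin n) (g : EuclideanSpace ℝ (Fin n) → Matrix (Fin n) (Fin n) ℝ)
    (y : EuclideanSpace ℝ (Fin n)) : EuclideanSpace ℝ (Fin n) :=
  (WithLp.equiv 2 (Fin n → ℝ)).symm fun i =>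
    (g y)⁻¹ i iN / Real.sqrt ((g y)⁻¹ iN iN)

/-- Normal derivative `D_{ν_g} u` at a boundary point. -/
def nuDeriv {n : ℕ} (iN : Fin n) (g : EuclideanSpace ℝ (Fin n) → Matrix (Fin n) (Fin n) ℝ)
    (u : EuclideanSpace ℝ (Fin n) → ℝ) (y : EuclideanSpace ℝ (Fin n)) : ℝ :=
  ∑ i, nuVec iN g y i * pd i u y

/-- `g` is a `C^m` Riemannian metric on the half-space. -/
def IsCmMetric {n : ℕ} (m : ℕ) (iN : Fin n)
    (g : EuclideanSpace ℝ (Fin n) → Matrix (Fin n) (Fin n) ℝ) : Prop :=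
  (∀ i j, ContDiffOn ℝ m (fun y => g y i j) (halfSpace iN)) ∧
    ∀ x ∈ halfSpace iN, (g x).IsSymm ∧ (g x).PosDef

/-- `g` is `C²`-asymptotically flat of rate `τ` on the half-space. -/
def IsAsymptoticallyFlat {n : ℕ} (iN : Fin n) (τ : ℝ)
    (g : EuclideanSpace ℝ (Fin n) → Matrix (Fin n) (Fin n) ℝ) : Prop :=
  ∃ C₀ > 0, ∀ x ∈ halfSpace iN, 1 ≤ ‖x‖ →
    (∀ i j, |g x i j - (1 : Matrix (Fin n) (Fin n) ℝ) i j| ≤ C₀ * ‖x‖ ^ (-τ)) ∧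
    (∀ i j k, |pd k (fun y => g y i j) x| ≤ C₀ * ‖x‖ ^ (-1 - τ)) ∧
    (∀ i j k l, |pd l (pd k (fun y => g y i j)) x| ≤ C₀ * ‖x‖ ^ (-2 - τ))

/-- The closed upper half-sphere of radius `lam`. -/
def halfSphere {n : ℕ} (iN : Fin n) (lam : ℝ) : Set (EuclideanSpace ℝ (Fin n)) :=
  {x | ‖x‖ = lam ∧ 0 ≤ x iN}

/-- The flux integral `∫_{ℝⁿ₊ ∩ S_λ} Σᵢ xⁱ ∂ᵢu dμ(ḡ)`, with `dμ(ḡ)` the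
`(n-1)`-dimensional Euclidean (Hausdorff) surface measure. -/
def flux {n : ℕ} (iN : Fin n) (u : EuclideanSpace ℝ (Fin n) → ℝ) (lam : ℝ) : ℝ :=
  ∫ x in halfSphere iN lam, (∑ i, x i * pd i u x) ∂(μH[(n : ℝ) - 1])

/-- Euclidean norm of the gradient. -/
def gradNorm {n : ℕ} (u : EuclideanSpace ℝ (Fin n) → ℝ) (x : EuclideanSpace ℝ (Fin n)) : ℝ :=
  Real.sqrt (∑ i, (pd i u x) ^ 2)

/-- Frobenius norm of the Hessian. -/
def hessNorm {n : ℕ} (u : EuclideanSpace ℝ (Fin n) → ℝ) (x : EuclideanSpace ℝ (Fin n)) : ℝ :=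
  Real.sqrt (∑ i, ∑ j, (pd i (pd j u) x) ^ 2)

/-- The Euclidean Laplacian. -/
def euclLap {n : ℕ} (u : EuclideanSpace ℝ (Fin n) → ℝ) (x : EuclideanSpace ℝ (Fin n)) : ℝ :=
  ∑ i, pd i (pd i u) x

/-- The barrier function associated to `τ` and `η`. -/
def barrier {n : ℕ} (iN : Fin n) (τ : ℝ) (η : ℝ → ℝ)
    (x : EuclideanSpace ℝ (Fin n)) : ℝ :=
  -(Real.log ‖x‖)⁻¹ * ‖x‖ ^ ((2 : ℝ) - n) + η (x iN / ‖x‖) * ‖x‖ ^ ((2 : ℝ) - n - τ)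

/-- The Euclidean area of the unit `(n-1)`-sphere in `ℝⁿ`. -/
def sphereArea (n : ℕ) : ℝ :=
  (μH[(n : ℝ) - 1] (Metric.sphere (0 : EuclideanSpace ℝ (Fin n)) 1)).toReal

/-- The quantity whose limit (after normalization) is the half-space mass. -/
def massExpr {n : ℕ} (iN : Fin n)
    (g : EuclideanSpace ℝ (Fin n) → Matrix (Fin n) (Fin n) ℝ) (lam : ℝ) : ℝ :=
  lam⁻¹ *
    ((∫ x in halfSphere iN lam,
        (∑ i, ∑ j, x i * (pd j (fun y => g y i j) x - pd i (fun y => g y j j) x))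
        ∂(μH[(n : ℝ) - 1])) +
      ∫ x in {x : EuclideanSpace ℝ (Fin n) | ‖x‖ = lam ∧ x iN = 0},
        (∑ i ∈ Finset.univ.erase iN, x i * g x i iN) ∂(μH[(n : ℝ) - 2]))

/-- `m` is the half-space (ADM-type) mass of `g`. -/
def HasHalfSpaceMass {n : ℕ} (iN : Fin n)
    (g : EuclideanSpace ℝ (Fin n) → Matrix (Fin n) (Fin n) ℝ) (m : ℝ) : Prop :=
  Filter.Tendsto (fun lam => (2 * ((n : ℝ) - 1) * sphereArea n)⁻¹ * massExpr iN g lam)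
    Filter.atTop (nhds m)

/-- Membership in the weighted Hölder space `C^{2,α}_τ(ℝⁿ₊)`. -/
def MemC2AlphaTau {n : ℕ} (iN : Fin n) (α τ : ℝ)
    (u : EuclideanSpace ℝ (Fin n) → ℝ) : Prop :=
  ContDiffOn ℝ 2 u (halfSpace iN) ∧
  ∃ C₁ > 0,
    (∀ x ∈ halfSpace iN,
      |u x| ≤ C₁ * (1 + ‖x‖) ^ (-τ) ∧
      (∀ i, |pd i u x| ≤ C₁ * (1 + ‖x‖) ^ (-1 - τ)) ∧
      (∀ i j, |pd i (pd j u) x| ≤ C₁ * (1 + ‖x‖) ^ (-2 - τ))) ∧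
    ∀ x₁ ∈ halfSpace iN, ∀ x₂ ∈ halfSpace iN, 1 ≤ ‖x₁‖ → 2 * ‖x₁ - x₂‖ ≤ ‖x₁‖ →
      ∀ i j, |pd i (pd j u) x₁ - pd i (pd j u) x₂| ≤
        C₁ * ‖x₁ - x₂‖ ^ α * ‖x₁‖ ^ (-2 - τ - α)


/-- The norm of a Euclidean space, away from the origin, has gradient `x / ‖x‖`. -/
theorem hasFDerivAt_euclidean_norm {n : ℕ} {x : EuclideanSpace ℝ (Fin n)} (hx : x ≠ 0) :
    HasFDerivAt (fun y : EuclideanSpace ℝ (Fin n) => ‖y‖) (‖x‖⁻¹ • innerSL ℝ x) x := by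
  have h := (hasStrictFDerivAt_norm_sq x).hasFDerivAt.sqrt (by simpa using hx)
  have hx' : ‖x‖ ≠ 0 := norm_ne_zero_iff.mpr hx
  simp only [Real.sqrt_sq (norm_nonneg _)] at h
  refine h.congr_fderiv ?_
  ext v
  simp
  field_simp

theorem hasFDerivAt_coord {n : ℕ} (i : Fin n) (x : EuclideanSpace ℝ (Fin n)) :
    HasFDerivAt (fun y : EuclideanSpace ℝ (Fin n) => y i)
      (EuclideanSpace.proj i : EuclideanSpace ℝ (Fin n) →L[ℝ] ℝ) x :=
  (EuclideanSpace.proj i : EuclideanSpace ℝ (Fin n) →L[ℝ] ℝ).hasFDerivAt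

theorem hasFDerivAt_radial {n : ℕ} {φ : ℝ → ℝ} {φ' : ℝ} {x : EuclideanSpace ℝ (Fin n)}
    (hx : x ≠ 0) (hφ : HasDerivAt φ (‖x‖ * φ') ‖x‖) :
    HasFDerivAt (fun y : EuclideanSpace ℝ (Fin n) => φ ‖y‖) (φ' • innerSL ℝ x) x := by
  have hx' : ‖x‖ ≠ 0 := norm_ne_zero_iff.mpr hx
  refine (hφ.comp_hasFDerivAt x (hasFDerivAt_euclidean_norm hx)).congr_fderiv ?_
  ext v
  simp
  field_simp

theorem pd_radial {n : ℕ} {φ : ℝ → ℝ} {φ' : ℝ} {x : EuclideanSpace ℝ (Fin n)}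
    (hx : x ≠ 0) (hφ : HasDerivAt φ (‖x‖ * φ') ‖x‖) (i : Fin n) :
    pd i (fun y => φ ‖y‖) x = φ' * x i := by
  simp [pd, (hasFDerivAt_radial hx hφ).fderiv, EuclideanSpace.inner_single_right]

theorem pd_radial_mul_coord {n : ℕ} {φ : ℝ → ℝ} {φ' : ℝ} {x : EuclideanSpace ℝ (Fin n)}
    (hx : x ≠ 0) (hφ : HasDerivAt φ (‖x‖ * φ') ‖x‖) (i j : Fin n) :
    pd i (fun y => φ ‖y‖ * y j) x =
      φ' * (x i * x j) + φ ‖x‖ * (1 : Matrix (Fin n) (Fin n) ℝ) i j := by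
  rw [pd, ((hasFDerivAt_radial hx hφ).fun_mul (hasFDerivAt_coord j x)).fderiv]
  simp [EuclideanSpace.inner_single_right, Matrix.one_apply, PiLp.single_apply, eq_comm (a := j)]
  ring

theorem pd_add {n : ℕ} {u v : EuclideanSpace ℝ (Fin n) → ℝ} {x : EuclideanSpace ℝ (Fin n)}
    (hu : DifferentiableAt ℝ u x) (hv : DifferentiableAt ℝ v x) (i : Fin n) :
    pd i (fun y => u y + v y) x = pd i u x + pd i v x := by
  simp [pd, fderiv_fun_add hu hv]

theorem pd_congr {n : ℕ} {u v : EuclideanSpace ℝ (Fin n) → ℝ} {x : EuclideanSpace ℝ (Fin n)}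
    (h : u =ᶠ[𝓝 x] v) (i : Fin n) : pd i u x = pd i v x := by
  rw [pd, pd, h.fderiv_eq]

/-- Positive homogeneity of degree `d` away from the origin. -/
def PosHomogeneous {n : ℕ} (d : ℝ) (G : EuclideanSpace ℝ (Fin n) → ℝ) : Prop :=
  ∀ c : ℝ, 0 < c → ∀ x, x ≠ 0 → G (c • x) = c ^ d * G x

theorem ContDiffOn.pd_compl_zero {n : ℕ} {G : EuclideanSpace ℝ (Fin n) → ℝ}
    (hG : ContDiffOn ℝ (⊤ : ℕ∞) G {0}ᶜ) (i : Fin n) :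
    ContDiffOn ℝ (⊤ : ℕ∞) (pd i G) {0}ᶜ :=
  (hG.fderiv_of_isOpen isOpen_compl_singleton (by simp)).clm_apply contDiffOn_const

theorem ContDiffOn.differentiableAt_of_ne_zero {n : ℕ} {G : EuclideanSpace ℝ (Fin n) → ℝ}
    (hG : ContDiffOn ℝ (⊤ : ℕ∞) G {0}ᶜ) {x : EuclideanSpace ℝ (Fin n)} (hx : x ≠ 0) :
    DifferentiableAt ℝ G x :=
  (hG.contDiffAt (isOpen_compl_singleton.mem_nhds hx)).differentiableAt (by simp)

theorem PosHomogeneous.pd {n : ℕ} {d : ℝ} {G : EuclideanSpace ℝ (Fin n) → ℝ}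
    (h : PosHomogeneous d G) (hG : ContDiffOn ℝ (⊤ : ℕ∞) G {0}ᶜ) (i : Fin n) :
    PosHomogeneous (d - 1) (pd i G) := by
  intro c hc x hx
  have hcx : c • x ≠ 0 := smul_ne_zero hc.ne' hx
  have h1 : HasFDerivAt (fun y : EuclideanSpace ℝ (Fin n) => G (c • y)) _ x :=
    (hG.differentiableAt_of_ne_zero hcx).hasFDerivAt.comp x
      ((hasFDerivAt_id x).const_smul c)
  have h2 := (hG.differentiableAt_of_ne_zero hx).hasFDerivAt.const_mul (c ^ d)
  have h3 : (fun y => G (c • y)) =ᶠ[𝓝 x] fun y => c ^ d * G y := by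
    filter_upwards [isOpen_compl_singleton.mem_nhds hx] with y hy using h c hc y hy
  have h4 := congrArg (fun T => T (EuclideanSpace.single i (1 : ℝ)))
    (h1.unique (h2.congr_of_eventuallyEq h3))
  simp at h4
  rw [Real.rpow_sub_one hc.ne']
  change c * _root_.pd i G (c • x) = c ^ d * _root_.pd i G x at h4
  field_simp
  linarith

theorem PosHomogeneous.exists_bound {n : ℕ} {d : ℝ} {G : EuclideanSpace ℝ (Fin n) → ℝ}
    (h : PosHomogeneous d G) (hG : ContinuousOn G {0}ᶜ) :
    ∃ C, ∀ x, x ≠ 0 → |G x| ≤ C * ‖x‖ ^ d := by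
  obtain ⟨C, hC⟩ := (isCompact_sphere (0 : EuclideanSpace ℝ (Fin n)) 1).exists_bound_of_continuousOn
    (hG.mono (fun x hx => by
      rintro rfl
      simp at hx))
  refine ⟨C, fun x hx => ?_⟩
  have hx' : 0 < ‖x‖ := norm_pos_iff.mpr hx
  have h1 := hC (‖x‖⁻¹ • x) (by simp [norm_smul, hx'.ne'])
  have h2 := h ‖x‖ hx' (‖x‖⁻¹ • x) (smul_ne_zero (inv_ne_zero hx'.ne') hx)
  rw [smul_inv_smul₀ hx'.ne'] at h2
  rw [h2, abs_mul, abs_of_nonneg (Real.rpow_nonneg hx'.le d), mul_comm]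
  exact mul_le_mul_of_nonneg_right h1 (Real.rpow_nonneg hx'.le d)

/-- The angular part of the barrier function. -/
def angularPart {n : ℕ} (iN : Fin n) (d : ℝ) (η : ℝ → ℝ) (x : EuclideanSpace ℝ (Fin n)) : ℝ :=
  η (x iN / ‖x‖) * ‖x‖ ^ d

theorem posHomogeneous_angularPart {n : ℕ} (iN : Fin n) (d : ℝ) (η : ℝ → ℝ) :
    PosHomogeneous d (angularPart iN d η) := by
  intro c hc x hx
  simp only [angularPart, norm_smul, PiLp.smul_apply, smul_eq_mul, Real.norm_eq_abs, abs_of_pos hc,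
    mul_div_mul_left _ _ hc.ne', Real.mul_rpow hc.le (norm_nonneg x)]
  ring

theorem contDiffOn_angularPart {n : ℕ} (iN : Fin n) (d : ℝ) {η : ℝ → ℝ}
    (hη : ContDiff ℝ (⊤ : ℕ∞) η) :
    ContDiffOn ℝ (⊤ : ℕ∞) (angularPart iN d η) {0}ᶜ := by
  intro x hx
  have hx' : x ≠ 0 := hx
  have hn : ‖x‖ ≠ 0 := norm_ne_zero_iff.mpr hx'
  have h1 : ContDiffAt ℝ (⊤ : ℕ∞) (fun y : EuclideanSpace ℝ (Fin n) => ‖y‖) x :=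
    contDiffAt_norm ℝ hx'
  have h2 : ContDiffAt ℝ (⊤ : ℕ∞) (fun y : EuclideanSpace ℝ (Fin n) => y iN) x :=
    (EuclideanSpace.proj iN : EuclideanSpace ℝ (Fin n) →L[ℝ] ℝ).contDiff.contDiffAt
  exact ((hη.contDiffAt.comp x (h2.div h1 hn)).mul (h1.rpow_const_of_ne hn)).contDiffWithinAt

theorem pd_angularPart_of_mem_bdry {n : ℕ} (iN : Fin n) (d : ℝ) {η : ℝ → ℝ}
    (hη : ContDiff ℝ (⊤ : ℕ∞) η) {y : EuclideanSpace ℝ (Fin n)} (hy : y iN = 0) (hy0 : y ≠ 0) :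
    pd iN (angularPart iN d η) y = deriv η 0 * ‖y‖ ^ (d - 1) := by
  have hn : ‖y‖ ≠ 0 := norm_ne_zero_iff.mpr hy0
  have h1 := hasFDerivAt_euclidean_norm hy0
  have h2 := (hasFDerivAt_coord iN y).fun_mul ((hasDerivAt_inv hn).comp_hasFDerivAt y h1)
  have h3 : HasDerivAt η (deriv η 0) (y iN * ‖y‖⁻¹) := by
    rw [hy, zero_mul]
    exact (hη.differentiable (by simp) 0).hasDerivAt
  have h4 := (h3.comp_hasFDerivAt y h2).fun_mul (h1.rpow_const (p := d) (Or.inl hn))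
  have h5 : fderiv ℝ (angularPart iN d η) y = _ := h4.fderiv
  rw [pd, h5, Real.rpow_sub_one hn]
  simp [hy, EuclideanSpace.inner_single_right]
  field_simp

/-- Entrywise stability of the matrix inverse near the identity. -/
theorem abs_inv_sub_one_le {n : ℕ} {M : Matrix (Fin n) (Fin n) ℝ} (hM : IsUnit M.det) {δ : ℝ}
    (h : ∀ i j, |M i j - (1 : Matrix (Fin n) (Fin n) ℝ) i j| ≤ δ) (hδ : (n : ℝ) ^ 2 * δ ≤ 1 / 2)
    (i j : Fin n) :
    |M⁻¹ i j - (1 : Matrix (Fin n) (Fin n) ℝ) i j| ≤ 2 * (n : ℝ) ^ 2 * δ := by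
  set N : Matrix (Fin n) (Fin n) ℝ := M⁻¹ - 1 with hN
  set K : ℝ := ∑ i, ∑ j, |N i j| with hK
  have hδ0 : 0 ≤ δ := (abs_nonneg _).trans (h i j)
  have hK0 : 0 ≤ K := Finset.sum_nonneg fun _ _ => Finset.sum_nonneg fun _ _ => abs_nonneg _
  have hle : ∀ k l, |N k l| ≤ K := fun k l =>
    (Finset.single_le_sum (f := fun l => |N k l|) (fun _ _ => abs_nonneg _)
      (Finset.mem_univ l)).trans
    (Finset.single_le_sum (f := fun k => ∑ l, |N k l|)
      (fun _ _ => Finset.sum_nonneg fun _ _ => abs_nonneg _) (Finset.mem_univ k))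
  have hcol : ∀ l, ∑ k, |N k l| ≤ K := fun l => by
    rw [hK]
    exact Finset.sum_le_sum fun k _ =>
      Finset.single_le_sum (f := fun l => |N k l|) (fun _ _ => abs_nonneg _) (Finset.mem_univ l)
  have hfix : N = -((M - 1) * (1 + N)) := by
    have : M * M⁻¹ = 1 := Matrix.mul_nonsing_inv M hM
    rw [hN, add_sub_cancel, sub_mul, this, one_mul, neg_sub]
  have hent : ∀ k l, |N k l| ≤ δ * (1 + K) := fun k l => by
    calc |N k l| = |∑ m, (M - 1) k m * (1 + N) m l| := by
          conv_lhs => rw [hfix]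
          rw [Matrix.neg_apply, abs_neg, Matrix.mul_apply]
      _ ≤ ∑ m, |(M - 1) k m * (1 + N) m l| := Finset.abs_sum_le_sum_abs _ _
      _ ≤ ∑ m, δ * ((1 : Matrix (Fin n) (Fin n) ℝ) m l + |N m l|) := by
          refine Finset.sum_le_sum fun m _ => ?_
          rw [abs_mul]
          refine mul_le_mul (h k m) ?_ (abs_nonneg _) hδ0
          refine (abs_add_le _ _).trans (add_le_add_left (le_of_eq (abs_of_nonneg ?_)) _)
          rw [Matrix.one_apply]
          split_ifs <;> norm_num
      _ ≤ δ * (1 + K) := by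
          rw [← Finset.mul_sum, Finset.sum_add_distrib]
          refine mul_le_mul_of_nonneg_left (add_le_add (le_of_eq ?_) (hcol l)) hδ0
          simp [Matrix.one_apply]
  have hsum : K ≤ (n : ℝ) ^ 2 * δ * (1 + K) := by
    calc K ≤ ∑ _i : Fin n, ∑ _j : Fin n, δ * (1 + K) :=
          Finset.sum_le_sum fun k _ => Finset.sum_le_sum fun l _ => hent k l
      _ = (n : ℝ) ^ 2 * δ * (1 + K) := by
          simp
          ring
  have := hle i j
  rw [hN, Matrix.sub_apply] at this
  nlinarith

/-- Minus the inverse logarithm times `r ^ (2 - n)`, the radial profile of the barrier. -/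
def logProfile (n : ℕ) (r : ℝ) : ℝ := -(Real.log r)⁻¹ * r ^ ((2 : ℝ) - n)

/-- `r⁻¹` times the derivative of `logProfile`. -/
def logProfile₁ (n : ℕ) (r : ℝ) : ℝ :=
  r ^ (-(n : ℝ)) * ((Real.log r)⁻¹ ^ 2 + ((n : ℝ) - 2) * (Real.log r)⁻¹)

/-- `r⁻¹` times the derivative of `logProfile₁`. -/
def logProfile₂ (n : ℕ) (r : ℝ) : ℝ :=
  r ^ (-(n : ℝ) - 2) * (-2 * (Real.log r)⁻¹ ^ 3 - (2 * (n : ℝ) - 2) * (Real.log r)⁻¹ ^ 2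
    - (n : ℝ) * ((n : ℝ) - 2) * (Real.log r)⁻¹)

theorem hasDerivAt_logProfile (n : ℕ) {r : ℝ} (hr : 1 < r) :
    HasDerivAt (logProfile n) (r * logProfile₁ n r) r := by
  have h0 : 0 < r := by linarith
  have hL : Real.log r ≠ 0 := (Real.log_pos hr).ne'
  have h := ((Real.hasDerivAt_log h0.ne').inv hL).neg.mul
    (Real.hasDerivAt_rpow_const (p := (2 : ℝ) - n) (Or.inl h0.ne'))
  refine HasDerivAt.congr_deriv h ?_
  have e1 : r ^ ((2 : ℝ) - n) = r ^ 2 * r ^ (-(n : ℝ)) := by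
    rw [sub_eq_add_neg, Real.rpow_add h0, Real.rpow_two]
  have e2 : r ^ ((2 : ℝ) - n - 1) = r * r ^ (-(n : ℝ)) := by
    rw [Real.rpow_sub_one h0.ne', e1]
    field_simp
  simp only [logProfile₁, e1, e2, Pi.neg_apply, Pi.inv_apply]
  field_simp
  ring

theorem hasDerivAt_logProfile₁ (n : ℕ) {r : ℝ} (hr : 1 < r) :
    HasDerivAt (logProfile₁ n) (r * logProfile₂ n r) r := by
  have h0 : 0 < r := by linarith
  have hL : Real.log r ≠ 0 := (Real.log_pos hr).ne'
  have hi := (Real.hasDerivAt_log h0.ne').fun_inv hL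
  have h := (Real.hasDerivAt_rpow_const (p := -(n : ℝ)) (Or.inl h0.ne')).mul
    ((hi.fun_pow 2).add (hi.const_mul ((n : ℝ) - 2)))
  refine HasDerivAt.congr_deriv h ?_
  have e1 : r ^ (-(n : ℝ) - 1) = r ^ (-(n : ℝ)) / r := Real.rpow_sub_one h0.ne' _
  have e2 : r ^ (-(n : ℝ) - 2) = r ^ (-(n : ℝ)) / r ^ 2 := by
    rw [Real.rpow_sub h0, Real.rpow_two]
  simp only [logProfile₂, e1, e2, Pi.add_apply, Nat.cast_ofNat, Nat.add_one_sub_one, pow_one]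
  field_simp
  ring

theorem sq_mul_logProfile₂_add (n : ℕ) {r : ℝ} (hr : 1 < r) :
    r ^ 2 * logProfile₂ n r + n * logProfile₁ n r =
      r ^ (-(n : ℝ)) * (-2 * (Real.log r)⁻¹ ^ 3 - ((n : ℝ) - 2) * (Real.log r)⁻¹ ^ 2) := by
  have h0 : 0 < r := by linarith
  have e2 : r ^ (-(n : ℝ) - 2) = r ^ (-(n : ℝ)) / r ^ 2 := by
    rw [Real.rpow_sub h0, Real.rpow_two]
  simp only [logProfile₂, logProfile₁, e2]
  field_simp
  ring

theorem barrier_eq {n : ℕ} (iN : Fin n) (τ : ℝ) (η : ℝ → ℝ) :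
    barrier iN τ η = fun x => logProfile n ‖x‖ + angularPart iN ((2 : ℝ) - n - τ) η x := rfl

theorem pd_barrier {n : ℕ} (iN : Fin n) (τ : ℝ) {η : ℝ → ℝ} (hη : ContDiff ℝ (⊤ : ℕ∞) η)
    {x : EuclideanSpace ℝ (Fin n)} (hx : 1 < ‖x‖) (i : Fin n) :
    pd i (barrier iN τ η) x =
      logProfile₁ n ‖x‖ * x i + pd i (angularPart iN ((2 : ℝ) - n - τ) η) x := by
  have hx0 : x ≠ 0 := norm_pos_iff.mp (by linarith)
  have h := hasDerivAt_logProfile n hx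
  rw [barrier_eq, pd_add (hasFDerivAt_radial hx0 h).differentiableAt
    ((contDiffOn_angularPart iN _ hη).differentiableAt_of_ne_zero hx0), pd_radial hx0 h]

theorem pd_pd_barrier {n : ℕ} (iN : Fin n) (τ : ℝ) {η : ℝ → ℝ} (hη : ContDiff ℝ (⊤ : ℕ∞) η)
    {x : EuclideanSpace ℝ (Fin n)} (hx : 1 < ‖x‖) (i j : Fin n) :
    pd i (pd j (barrier iN τ η)) x =
      (logProfile₂ n ‖x‖ * (x i * x j) +
        logProfile₁ n ‖x‖ * (1 : Matrix (Fin n) (Fin n) ℝ) i j) +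
      pd i (pd j (angularPart iN ((2 : ℝ) - n - τ) η)) x := by
  have hx0 : x ≠ 0 := norm_pos_iff.mp (by linarith)
  have h := hasDerivAt_logProfile₁ n hx
  have hev : pd j (barrier iN τ η) =ᶠ[𝓝 x] fun y =>
      logProfile₁ n ‖y‖ * y j + pd j (angularPart iN ((2 : ℝ) - n - τ) η) y := by
    filter_upwards [(isOpen_lt continuous_const continuous_norm).mem_nhds hx] with y hy
      using pd_barrier iN τ hη hy j
  rw [pd_congr hev, pd_add
    ((hasFDerivAt_radial hx0 h).fun_mul (hasFDerivAt_coord j x)).differentiableAt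
    (((contDiffOn_angularPart iN _ hη).pd_compl_zero j).differentiableAt_of_ne_zero hx0),
    pd_radial_mul_coord hx0 h]

/-- The filter of neighbourhoods of infinity in the closed half-space. -/
def atInfinity {n : ℕ} (iN : Fin n) : Filter (EuclideanSpace ℝ (Fin n)) :=
  Filter.comap (fun x => ‖x‖) Filter.atTop ⊓ Filter.principal (halfSpace iN)

theorem eventually_atInfinity_iff {n : ℕ} {iN : Fin n} {P : EuclideanSpace ℝ (Fin n) → Prop} :
    (∀ᶠ x in atInfinity iN, P x) ↔
      ∃ lam₀ > (1 : ℝ), ∀ x ∈ halfSpace iN, lam₀ < ‖x‖ → P x := by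
  rw [atInfinity, Filter.eventually_inf_principal, Filter.eventually_comap]
  constructor
  · intro h
    obtain ⟨a, ha⟩ := Filter.eventually_atTop.mp h
    exact ⟨max a 2, lt_max_of_lt_right one_lt_two, fun x hx hl =>
      ha ‖x‖ ((le_max_left _ _).trans hl.le) x rfl hx⟩
  · rintro ⟨a, -, ha⟩
    filter_upwards [Filter.eventually_gt_atTop a] with b hb x hx hxs
    exact ha x hxs (hx ▸ hb)

theorem tendsto_norm_atInfinity {n : ℕ} (iN : Fin n) :
    Filter.Tendsto (fun x : EuclideanSpace ℝ (Fin n) => ‖x‖) (atInfinity iN) Filter.atTop :=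
  Filter.tendsto_comap.mono_left inf_le_left

theorem eventually_one_lt_norm {n : ℕ} (iN : Fin n) : ∀ᶠ x in atInfinity iN, 1 < ‖x‖ :=
  (tendsto_norm_atInfinity iN).eventually_gt_atTop 1

theorem eventually_mem_halfSpace {n : ℕ} (iN : Fin n) :
    ∀ᶠ x in atInfinity iN, x ∈ halfSpace iN :=
  Filter.mem_inf_of_right (Filter.mem_principal_self _)

theorem rpow_norm_mul_eventuallyEq {n : ℕ} (iN : Fin n) {a b c : ℝ} (h : a + b = c) :
    (fun x : EuclideanSpace ℝ (Fin n) => ‖x‖ ^ a * ‖x‖ ^ b) =ᶠ[atInfinity iN]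
      fun x => ‖x‖ ^ c := by
  filter_upwards [eventually_one_lt_norm iN] with x hx
  rw [← h, Real.rpow_add (by linarith)]

theorem isBigO_mul_rpow_norm {n : ℕ} {iN : Fin n} {u v : EuclideanSpace ℝ (Fin n) → ℝ}
    {a b c : ℝ} (hu : u =O[atInfinity iN] fun x => ‖x‖ ^ a)
    (hv : v =O[atInfinity iN] fun x => ‖x‖ ^ b) (h : a + b = c) :
    (fun x => u x * v x) =O[atInfinity iN] fun x => ‖x‖ ^ c :=
  (hu.mul hv).congr' Filter.EventuallyEq.rfl (rpow_norm_mul_eventuallyEq iN h)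

theorem isBigO_mul_isLittleO_rpow_norm {n : ℕ} {iN : Fin n}
    {u v : EuclideanSpace ℝ (Fin n) → ℝ}
    {a b c : ℝ} (hu : u =O[atInfinity iN] fun x => ‖x‖ ^ a)
    (hv : v =o[atInfinity iN] fun x => ‖x‖ ^ b) (h : a + b = c) :
    (fun x => u x * v x) =o[atInfinity iN] fun x => ‖x‖ ^ c :=
  (hu.mul_isLittleO hv).congr' Filter.EventuallyEq.rfl (rpow_norm_mul_eventuallyEq iN h)

theorem isBigO_of_forall_abs_le {n : ℕ} {iN : Fin n} {u : EuclideanSpace ℝ (Fin n) → ℝ}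
    {C a : ℝ} (h : ∀ x ∈ halfSpace iN, 1 < ‖x‖ → |u x| ≤ C * ‖x‖ ^ a) :
    u =O[atInfinity iN] fun x => ‖x‖ ^ a := by
  refine Asymptotics.IsBigO.of_bound C ?_
  filter_upwards [eventually_one_lt_norm iN, eventually_mem_halfSpace iN] with x hx hxs
  rw [Real.norm_eq_abs, Real.norm_eq_abs, abs_of_nonneg (Real.rpow_nonneg (norm_nonneg x) a)]
  exact h x hxs hx

theorem tendsto_inv_log_norm {n : ℕ} (iN : Fin n) :
    Filter.Tendsto (fun x : EuclideanSpace ℝ (Fin n) => (Real.log ‖x‖)⁻¹) (atInfinity iN)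
      (𝓝 0) :=
  Filter.Tendsto.inv_tendsto_atTop
    (Real.tendsto_log_atTop.comp (tendsto_norm_atInfinity iN))

/-- Polynomial decay beats logarithmic decay. -/
theorem isLittleO_rpow_norm_mul_inv_log_pow {n : ℕ} (iN : Fin n) {a b : ℝ} (h : a < b) (k : ℕ) :
    (fun x : EuclideanSpace ℝ (Fin n) => ‖x‖ ^ a) =o[atInfinity iN]
      fun x => ‖x‖ ^ b * (Real.log ‖x‖)⁻¹ ^ k := by
  have h1 := (isLittleO_log_rpow_rpow_atTop (k : ℝ) (sub_pos.mpr h)).comp_tendsto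
    (tendsto_norm_atInfinity iN)
  have h2 := h1.mul_isBigO (Asymptotics.isBigO_refl
    (fun x : EuclideanSpace ℝ (Fin n) => ‖x‖ ^ a * (Real.log ‖x‖)⁻¹ ^ k) (atInfinity iN))
  refine h2.congr' ?_ ?_
  · filter_upwards [eventually_one_lt_norm iN] with x hx
    have : Real.log ‖x‖ ≠ 0 := (Real.log_pos hx).ne'
    simp only [Function.comp, Real.rpow_natCast]
    rw [mul_left_comm, ← mul_pow, mul_inv_cancel₀ this, one_pow, mul_one]
  · filter_upwards [eventually_one_lt_norm iN] with x hx
    simp only [Function.comp]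
    rw [← mul_assoc, ← Real.rpow_add (by linarith), sub_add_cancel]

theorem isLittleO_rpow_norm {n : ℕ} (iN : Fin n) {a b : ℝ} (h : a < b) :
    (fun x : EuclideanSpace ℝ (Fin n) => ‖x‖ ^ a) =o[atInfinity iN] fun x => ‖x‖ ^ b:= by
  simpa using isLittleO_rpow_norm_mul_inv_log_pow iN h 0

theorem isBigO_coord {n : ℕ} (iN i : Fin n) :
    (fun x : EuclideanSpace ℝ (Fin n) => x i) =O[atInfinity iN] fun x => ‖x‖ ^ (1 : ℝ) :=
  isBigO_of_forall_abs_le (C := 1) fun x _ _ => by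
    simpa using PiLp.norm_apply_le x i

theorem isLittleO_logProfile₁ {n : ℕ} (iN : Fin n) :
    (fun x : EuclideanSpace ℝ (Fin n) => logProfile₁ n ‖x‖) =o[atInfinity iN]
      fun x => ‖x‖ ^ (-(n : ℝ)) := by
  have h := tendsto_inv_log_norm iN
  have h1 : Filter.Tendsto (fun x : EuclideanSpace ℝ (Fin n) =>
      (Real.log ‖x‖)⁻¹ ^ 2 + ((n : ℝ) - 2) * (Real.log ‖x‖)⁻¹) (atInfinity iN) (𝓝 0) := by
    simpa using (h.pow 2).add (h.const_mul ((n : ℝ) - 2))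
  simpa [logProfile₁] using (Asymptotics.isBigO_refl
    (fun x : EuclideanSpace ℝ (Fin n) => ‖x‖ ^ (-(n : ℝ))) (atInfinity iN)).mul_isLittleO
    ((Asymptotics.isLittleO_one_iff ℝ).mpr h1)

theorem isBigO_logProfile₂ {n : ℕ} (iN : Fin n) :
    (fun x : EuclideanSpace ℝ (Fin n) => logProfile₂ n ‖x‖) =O[atInfinity iN]
      fun x => ‖x‖ ^ (-(n : ℝ) - 2) := by
  have h := tendsto_inv_log_norm iN
  have h1 := (((h.pow 3).const_mul (-2)).sub ((h.pow 2).const_mul (2 * (n : ℝ) - 2))).sub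
    (h.const_mul ((n : ℝ) * ((n : ℝ) - 2)))
  simpa [logProfile₂] using (Asymptotics.isBigO_refl
    (fun x : EuclideanSpace ℝ (Fin n) => ‖x‖ ^ (-(n : ℝ) - 2)) (atInfinity iN)).mul
    (h1.isBigO_one ℝ)

theorem isBigO_angularPart {n : ℕ} (iN : Fin n) (d : ℝ) {η : ℝ → ℝ}
    (hη : ContDiff ℝ (⊤ : ℕ∞) η) :
    angularPart iN d η =O[atInfinity iN] fun x => ‖x‖ ^ d := by
  obtain ⟨C, hC⟩ := (posHomogeneous_angularPart iN d η).exists_bound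
    (contDiffOn_angularPart iN d hη).continuousOn
  exact isBigO_of_forall_abs_le fun x _ hx => hC x (norm_pos_iff.mp (by linarith))

theorem isBigO_pd_angularPart {n : ℕ} (iN : Fin n) (d : ℝ) {η : ℝ → ℝ}
    (hη : ContDiff ℝ (⊤ : ℕ∞) η) (i : Fin n) :
    pd i (angularPart iN d η) =O[atInfinity iN] fun x => ‖x‖ ^ (d - 1) := by
  have h := contDiffOn_angularPart iN d hη
  obtain ⟨C, hC⟩ := ((posHomogeneous_angularPart iN d η).pd h i).exists_bound
    (h.pd_compl_zero i).continuousOn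
  exact isBigO_of_forall_abs_le fun x _ hx => hC x (norm_pos_iff.mp (by linarith))

theorem isBigO_pd_pd_angularPart {n : ℕ} (iN : Fin n) (d : ℝ) {η : ℝ → ℝ}
    (hη : ContDiff ℝ (⊤ : ℕ∞) η) (i j : Fin n) :
    pd i (pd j (angularPart iN d η)) =O[atInfinity iN] fun x => ‖x‖ ^ (d - 1 - 1) := by
  have h := contDiffOn_angularPart iN d hη
  obtain ⟨C, hC⟩ := (((posHomogeneous_angularPart iN d η).pd h j).pd
    (h.pd_compl_zero j) i).exists_bound ((h.pd_compl_zero j).pd_compl_zero i).continuousOn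
  exact isBigO_of_forall_abs_le fun x _ hx => hC x (norm_pos_iff.mp (by linarith))

theorem isLittleO_pd_barrier {n : ℕ} (iN : Fin n) {τ : ℝ} (hτ : 0 < τ) {η : ℝ → ℝ}
    (hη : ContDiff ℝ (⊤ : ℕ∞) η) (i : Fin n) :
    pd i (barrier iN τ η) =o[atInfinity iN] fun x => ‖x‖ ^ ((1 : ℝ) - n) := by
  have h1 := isBigO_mul_isLittleO_rpow_norm (isBigO_coord iN i) (isLittleO_logProfile₁ iN)
    (c := (1 : ℝ) - n) (by ring)
  have h2 := (isBigO_pd_angularPart iN ((2 : ℝ) - n - τ) hη i).trans_isLittleO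
    (isLittleO_rpow_norm iN (b := (1 : ℝ) - n) (by linarith))
  refine (h1.add h2).congr' ?_ Filter.EventuallyEq.rfl
  filter_upwards [eventually_one_lt_norm iN] with x hx
  rw [pd_barrier iN τ hη hx, mul_comm]

theorem isBigO_pd_pd_barrier {n : ℕ} (iN : Fin n) {τ : ℝ} (hτ : 0 < τ) {η : ℝ → ℝ}
    (hη : ContDiff ℝ (⊤ : ℕ∞) η) (i j : Fin n) :
    pd i (pd j (barrier iN τ η)) =O[atInfinity iN] fun x => ‖x‖ ^ (-(n : ℝ)) := by
  have h1 := isBigO_mul_rpow_norm (isBigO_logProfile₂ iN)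
    (isBigO_mul_rpow_norm (isBigO_coord iN i) (isBigO_coord iN j) rfl)
    (c := -(n : ℝ)) (by ring)
  have h2 := ((isLittleO_logProfile₁ iN).isBigO).const_mul_left
    ((1 : Matrix (Fin n) (Fin n) ℝ) i j)
  have h3 := (isBigO_pd_pd_angularPart iN ((2 : ℝ) - n - τ) hη i j).trans
    (isLittleO_rpow_norm iN (b := -(n : ℝ)) (by linarith)).isBigO
  refine ((h1.add h2).add h3).congr' ?_ Filter.EventuallyEq.rfl
  filter_upwards [eventually_one_lt_norm iN] with x hx
  rw [pd_pd_barrier iN τ hη hx, mul_comm (logProfile₁ n ‖x‖)]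

theorem euclLap_barrier {n : ℕ} (iN : Fin n) (τ : ℝ) {η : ℝ → ℝ}
    (hη : ContDiff ℝ (⊤ : ℕ∞) η) {x : EuclideanSpace ℝ (Fin n)} (hx : 1 < ‖x‖) :
    euclLap (barrier iN τ η) x =
      ‖x‖ ^ (-(n : ℝ)) *
        (-2 * (Real.log ‖x‖)⁻¹ ^ 3 - ((n : ℝ) - 2) * (Real.log ‖x‖)⁻¹ ^ 2) +
      euclLap (angularPart iN ((2 : ℝ) - n - τ) η) x := by
  rw [← sq_mul_logProfile₂_add n hx]
  simp only [euclLap, pd_pd_barrier iN τ hη hx, Finset.sum_add_distrib, ← Finset.mul_sum]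
  congr 1
  simp [EuclideanSpace.real_norm_sq_eq, ← pow_two]
  ring

theorem isBigO_inv_metric_sub_one {n : ℕ} {iN : Fin n} {τ : ℝ} (hτ : 0 < τ)
    {g : EuclideanSpace ℝ (Fin n) → Matrix (Fin n) (Fin n) ℝ}
    (hg : IsCmMetric 2 iN g) (hgAF : IsAsymptoticallyFlat iN τ g) (i j : Fin n) :
    (fun x => (g x)⁻¹ i j - (1 : Matrix (Fin n) (Fin n) ℝ) i j) =O[atInfinity iN]
      fun x => ‖x‖ ^ (-τ) := by
  obtain ⟨C, hC, h⟩ := hgAF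
  have hsmall : ∀ᶠ x in atInfinity iN, (n : ℝ) ^ 2 * (C * ‖x‖ ^ (-τ)) ≤ 1 / 2 := by
    have h0 := ((tendsto_rpow_neg_atTop hτ).comp (tendsto_norm_atInfinity iN)).const_mul
      ((n : ℝ) ^ 2 * C)
    rw [mul_zero] at h0
    filter_upwards [h0.eventually_lt_const (u := 1 / 2) (by norm_num)] with x hx
    rw [← mul_assoc]
    exact hx.le
  refine Asymptotics.IsBigO.of_bound (2 * (n : ℝ) ^ 2 * C) ?_
  filter_upwards [hsmall, eventually_one_lt_norm iN, eventually_mem_halfSpace iN]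
    with x hx h1 hxs
  rw [Real.norm_eq_abs, Real.norm_eq_abs, abs_of_nonneg (Real.rpow_nonneg (norm_nonneg x) _),
    mul_assoc]
  exact abs_inv_sub_one_le (hg.2 x hxs).2.det_pos.ne'.isUnit (h x hxs h1.le).1 hx i j

theorem isBigO_inv_metric {n : ℕ} {iN : Fin n} {τ : ℝ} (hτ : 0 < τ)
    {g : EuclideanSpace ℝ (Fin n) → Matrix (Fin n) (Fin n) ℝ}
    (hg : IsCmMetric 2 iN g) (hgAF : IsAsymptoticallyFlat iN τ g) (i j : Fin n) :
    (fun x => (g x)⁻¹ i j) =O[atInfinity iN] fun x => ‖x‖ ^ (0 : ℝ) := by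
  have h := ((isBigO_inv_metric_sub_one hτ hg hgAF i j).trans
    (isLittleO_rpow_norm iN (neg_lt_zero.mpr hτ)).isBigO)
  have h1 : (fun _ => (1 : Matrix (Fin n) (Fin n) ℝ) i j) =O[atInfinity iN]
      fun x : EuclideanSpace ℝ (Fin n) => ‖x‖ ^ (0 : ℝ) := by
    simpa using Asymptotics.isBigO_const_const
      ((1 : Matrix (Fin n) (Fin n) ℝ) i j) (one_ne_zero (α := ℝ)) (atInfinity iN)
  simpa using h.add h1

theorem isBigO_christoffel {n : ℕ} {iN : Fin n} {τ : ℝ} (hτ : 0 < τ)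
    {g : EuclideanSpace ℝ (Fin n) → Matrix (Fin n) (Fin n) ℝ}
    (hg : IsCmMetric 2 iN g) (hgAF : IsAsymptoticallyFlat iN τ g) (k i j : Fin n) :
    christoffel g k i j =O[atInfinity iN] fun x => ‖x‖ ^ (-1 - τ) := by
  have hd : ∀ i j k, pd k (fun y => g y i j) =O[atInfinity iN] fun x => ‖x‖ ^ (-1 - τ) := by
    intro i j k
    obtain ⟨C, -, h⟩ := hgAF
    exact isBigO_of_forall_abs_le fun x hx h1 => (h x hx h1.le).2.1 i j k
  refine Asymptotics.IsBigO.const_mul_left (Asymptotics.IsBigO.fun_sum fun l _ => ?_) _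
  exact isBigO_mul_rpow_norm (isBigO_inv_metric hτ hg hgAF k l)
    (((hd j l i).add (hd i l j)).sub (hd i j l)) (by ring)

theorem isBigO_laplaceBeltrami_sub_euclLap {n : ℕ} {iN : Fin n} {τ : ℝ} (hτ : 0 < τ)
    {g : EuclideanSpace ℝ (Fin n) → Matrix (Fin n) (Fin n) ℝ}
    (hg : IsCmMetric 2 iN g) (hgAF : IsAsymptoticallyFlat iN τ g)
    {η : ℝ → ℝ} (hη : ContDiff ℝ (⊤ : ℕ∞) η) :
    (fun x => laplaceBeltrami g (barrier iN τ η) x - euclLap (barrier iN τ η) x)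
      =O[atInfinity iN] fun x => ‖x‖ ^ (-(n : ℝ) - τ) := by
  have h1 : (fun x => ∑ i, ∑ j, (((g x)⁻¹ i j - (1 : Matrix (Fin n) (Fin n) ℝ) i j) *
      pd i (pd j (barrier iN τ η)) x - (g x)⁻¹ i j *
        ∑ k, christoffel g k i j x * pd k (barrier iN τ η) x))
      =O[atInfinity iN] fun x => ‖x‖ ^ (-(n : ℝ) - τ) := by
    refine Asymptotics.IsBigO.fun_sum fun i _ => Asymptotics.IsBigO.fun_sum fun j _ => ?_
    refine Asymptotics.IsBigO.sub ?_ ?_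
    · exact isBigO_mul_rpow_norm (isBigO_inv_metric_sub_one hτ hg hgAF i j)
        (isBigO_pd_pd_barrier iN hτ hη i j) (by ring)
    · refine isBigO_mul_rpow_norm (isBigO_inv_metric hτ hg hgAF i j)
        (Asymptotics.IsBigO.fun_sum fun k _ => ?_) (zero_add _)
      exact isBigO_mul_rpow_norm (isBigO_christoffel hτ hg hgAF k i j)
        (isLittleO_pd_barrier iN hτ hη k).isBigO (by ring)
  refine h1.congr_left fun x => ?_
  simp [laplaceBeltrami, euclLap, sub_mul, mul_sub, Matrix.one_apply, Finset.sum_sub_distrib]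
  ring

theorem eventually_laplaceBeltrami_barrier_neg {n : ℕ} (hn : 3 ≤ n) {iN : Fin n} {τ : ℝ}
    (hτ : 0 < τ) {g : EuclideanSpace ℝ (Fin n) → Matrix (Fin n) (Fin n) ℝ}
    (hg : IsCmMetric 2 iN g) (hgAF : IsAsymptoticallyFlat iN τ g)
    {η : ℝ → ℝ} (hη : ContDiff ℝ (⊤ : ℕ∞) η) :
    ∀ᶠ x in atInfinity iN, laplaceBeltrami g (barrier iN τ η) x < 0 := by
  have hang : euclLap (angularPart iN ((2 : ℝ) - n - τ) η) =O[atInfinity iN]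
      fun x => ‖x‖ ^ (-(n : ℝ) - τ) := by
    refine Asymptotics.IsBigO.fun_sum fun i _ => ?_
    rw [show -(n : ℝ) - τ = (2 : ℝ) - n - τ - 1 - 1 by ring]
    exact isBigO_pd_pd_angularPart iN ((2 : ℝ) - n - τ) hη i i
  have herr := ((isBigO_laplaceBeltrami_sub_euclLap hτ hg hgAF hη).add hang).trans_isLittleO
    (isLittleO_rpow_norm_mul_inv_log_pow iN (b := -(n : ℝ)) (by linarith) 2)
  filter_upwards [herr.bound (c := 1 / 2) (by norm_num), eventually_one_lt_norm iN]
    with x hx h1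
  have hL : 0 < (Real.log ‖x‖)⁻¹ := inv_pos.mpr (Real.log_pos h1)
  have hr : 0 < ‖x‖ ^ (-(n : ℝ)) := Real.rpow_pos_of_pos (by linarith) _
  have hn' : (3 : ℝ) ≤ n := by exact_mod_cast hn
  rw [euclLap_barrier iN τ hη h1, Real.norm_eq_abs, Real.norm_eq_abs,
    abs_of_pos (mul_pos hr (pow_pos hL 2))] at hx
  have hx' := (abs_le.mp hx).2
  have p2 := mul_pos hr (pow_pos hL 2)
  have p3 := mul_pos hr (pow_pos hL 3)
  nlinarith

theorem eventually_barrier_neg {n : ℕ} (iN : Fin n) {τ : ℝ} (hτ : 0 < τ)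
    {η : ℝ → ℝ} (hη : ContDiff ℝ (⊤ : ℕ∞) η) :
    ∀ᶠ x in atInfinity iN, barrier iN τ η x < 0 := by
  have h := (isBigO_angularPart iN ((2 : ℝ) - n - τ) hη).trans_isLittleO
    (isLittleO_rpow_norm_mul_inv_log_pow iN (b := (2 : ℝ) - n) (by linarith) 1)
  filter_upwards [h.bound (c := 1 / 2) (by norm_num), eventually_one_lt_norm iN] with x hx h1
  have hL : 0 < (Real.log ‖x‖)⁻¹ := inv_pos.mpr (Real.log_pos h1)
  have hr : 0 < ‖x‖ ^ ((2 : ℝ) - n) := Real.rpow_pos_of_pos (by linarith) _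
  have p := mul_pos hr hL
  rw [pow_one, Real.norm_eq_abs, Real.norm_eq_abs, abs_of_pos p] at hx
  have hx' := (abs_le.mp hx).2
  simp only [barrier_eq, logProfile]
  nlinarith

theorem pd_barrier_of_mem_bdry {n : ℕ} (iN : Fin n) (τ : ℝ) {η : ℝ → ℝ}
    (hη : ContDiff ℝ (⊤ : ℕ∞) η) {y : EuclideanSpace ℝ (Fin n)} (hy : y ∈ bdry iN)
    (h1 : 1 < ‖y‖) :
    pd iN (barrier iN τ η) y = deriv η 0 * ‖y‖ ^ ((1 : ℝ) - n - τ) := by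
  have hy0 : y iN = 0 := hy
  rw [pd_barrier iN τ hη h1, hy0, mul_zero, zero_add,
    pd_angularPart_of_mem_bdry iN _ hη hy0 (norm_pos_iff.mp (by linarith))]
  congr 2
  ring

theorem eventually_nuDeriv_barrier_neg {n : ℕ} {iN : Fin n} {τ : ℝ}
    (hτ : 0 < τ) {g : EuclideanSpace ℝ (Fin n) → Matrix (Fin n) (Fin n) ℝ}
    (hg : IsCmMetric 2 iN g) (hgAF : IsAsymptoticallyFlat iN τ g)
    {η : ℝ → ℝ} (hη : ContDiff ℝ (⊤ : ℕ∞) η) (hη0 : deriv η 0 < 0) :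
    ∀ᶠ y in atInfinity iN, y ∈ bdry iN → nuDeriv iN g (barrier iN τ η) y < 0 := by
  have h : (fun y => ∑ i, ((g y)⁻¹ i iN - (1 : Matrix (Fin n) (Fin n) ℝ) i iN) *
      pd i (barrier iN τ η) y) =o[atInfinity iN] fun y => ‖y‖ ^ ((1 : ℝ) - n - τ) :=
    Asymptotics.IsLittleO.fun_sum fun i _ => isBigO_mul_isLittleO_rpow_norm
      (isBigO_inv_metric_sub_one hτ hg hgAF i iN) (isLittleO_pd_barrier iN hτ hη i) (by ring)
  filter_upwards [h.bound (c := -deriv η 0 / 2) (by linarith), eventually_one_lt_norm iN,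
    eventually_mem_halfSpace iN] with y hy h1 hys hyb
  have hr : 0 < ‖y‖ ^ ((1 : ℝ) - n - τ) := Real.rpow_pos_of_pos (by linarith) _
  have hsq : 0 < Real.sqrt ((g y)⁻¹ iN iN) :=
    Real.sqrt_pos.mpr (hg.2 y hys).2.inv.diag_pos
  have hnu : nuDeriv iN g (barrier iN τ η) y =
      (∑ i, ((g y)⁻¹ i iN - (1 : Matrix (Fin n) (Fin n) ℝ) i iN) * pd i (barrier iN τ η) y +
        deriv η 0 * ‖y‖ ^ ((1 : ℝ) - n - τ)) / Real.sqrt ((g y)⁻¹ iN iN) := by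
    rw [← pd_barrier_of_mem_bdry iN τ hη hyb h1]
    simp [nuDeriv, nuVec, sub_mul, Finset.sum_sub_distrib, Matrix.one_apply, Finset.sum_div,
      div_mul_eq_mul_div]
  rw [hnu]
  refine div_neg_of_neg_of_pos ?_ hsq
  rw [Real.norm_eq_abs, Real.norm_eq_abs, abs_of_pos hr] at hy
  nlinarith [(abs_le.mp hy).2]

/-- properties of the barrier function. -/
theorem stmt3 (n : ℕ) (hn : 3 ≤ n) (τ : ℝ) (hτ : ((n : ℝ) - 2) / 2 < τ)
    (iN : Fin n) (hiN : (iN : ℕ) = n - 1)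
    (g : EuclideanSpace ℝ (Fin n) → Matrix (Fin n) (Fin n) ℝ)
    (hg : IsCmMetric 2 iN g) (hgAF : IsAsymptoticallyFlat iN τ g)
    (η : ℝ → ℝ) (hη : ContDiff ℝ (⊤ : ℕ∞) η)
    (hηvan : ∀ s : ℝ, 1 / 2 ≤ s → η s = 0) :
    (∃ lam₀ > (1 : ℝ), ∀ x ∈ halfSpace iN, lam₀ < ‖x‖ →
        barrier iN τ η x < 0 ∧ laplaceBeltrami g (barrier iN τ η) x < 0) ∧
    (∀ y ∈ bdry iN, 1 < ‖y‖ →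
        pd iN (barrier iN τ η) y = deriv η 0 * ‖y‖ ^ ((1 : ℝ) - n - τ)) ∧
    (deriv η 0 < 0 →
      ∃ lam₀ > (1 : ℝ),
        (∀ x ∈ halfSpace iN, lam₀ < ‖x‖ →
          barrier iN τ η x < 0 ∧ laplaceBeltrami g (barrier iN τ η) x < 0) ∧
        ∀ y ∈ bdry iN, lam₀ < ‖y‖ → nuDeriv iN g (barrier iN τ η) y < 0) := by
  have hn' : (3 : ℝ) ≤ n := by exact_mod_cast hn
  have hτ0 : 0 < τ := by linarith
  have hneg := (eventually_barrier_neg iN hτ0 hη).and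
    (eventually_laplaceBeltrami_barrier_neg hn hτ0 hg hgAF hη)
  refine ⟨eventually_atInfinity_iff.mp hneg,
    fun y hy h1 => pd_barrier_of_mem_bdry iN τ hη hy h1, fun hη0 => ?_⟩
  obtain ⟨lam₀, hlam, h⟩ := eventually_atInfinity_iff.mp
    (hneg.and (eventually_nuDeriv_barrier_neg hτ0 hg hgAF hη hη0))
  exact ⟨lam₀, hlam, fun x hx hl => (h x hx hl).1,
    fun y hy hl => (h y (show (0 : ℝ) ≤ y iN from (show y iN = 0 from hy).ge) hl).2 hy⟩

end
end

section
/- Let n ≥ 3 be an integer. There exist a smooth function ρ : ℝ^{n−1} → ℝ and a constant c > 0 with the following properties: (i) ρ(x) = 0 for every x ∈ ℝ^{n−1} with |x| ≥ 1; (ii) ρ(x) > 0 for every x ∈ ℝ^{n−1} with |x| < 1; and (iii) |ρ(x)| + |∇ρ(x)| + |D²ρ(x)| ≤ c·Δρ(x) for every x ∈ ℝ^{n−1} with 1/2 < |x| < 1. -/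
open MeasureTheory Real Filter Topology Finset

noncomputable section

/-- The flat bump `x ↦ exp (-a / (1 - ‖x‖²))`, extended by zero outside the unit ball. -/
def flatBump {m : ℕ} (a : ℝ) (x : EuclideanSpace ℝ (Fin m)) : ℝ :=
  expNegInvGlue ((1 - ‖x‖ ^ 2) / a)

theorem expNegInvGlue_hasDerivAt (s : ℝ) :
    HasDerivAt expNegInvGlue ((s⁻¹) ^ 2 * expNegInvGlue s) s := by
  simpa using expNegInvGlue.hasDerivAt_polynomial_eval_inv_mul 1 s

theorem expNegInvGlue_hasDerivAt_deriv (s : ℝ) :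
    HasDerivAt (fun t => (t⁻¹) ^ 2 * expNegInvGlue t)
      (((s⁻¹) ^ 4 - 2 * (s⁻¹) ^ 3) * expNegInvGlue s) s := by
  have h := expNegInvGlue.hasDerivAt_polynomial_eval_inv_mul (Polynomial.X ^ 2) s
  simp only [Polynomial.eval_pow, Polynomial.eval_X, Polynomial.eval_mul, Polynomial.eval_sub,
    Polynomial.derivative_X_pow, Polynomial.eval_C] at h
  convert h using 1
  push_cast
  ring

theorem pd_eq_of_hasFDerivAt {m : ℕ} {i : Fin m} {f : EuclideanSpace ℝ (Fin m) → ℝ}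
    {f' : EuclideanSpace ℝ (Fin m) →L[ℝ] ℝ} {x : EuclideanSpace ℝ (Fin m)}
    (h : HasFDerivAt f f' x) : pd i f x = f' (EuclideanSpace.single i 1) := by
  rw [pd, h.fderiv]

theorem hasFDerivAt_one_sub_norm_sq_div {m : ℕ} (a : ℝ) (x : EuclideanSpace ℝ (Fin m)) :
    HasFDerivAt (fun y : EuclideanSpace ℝ (Fin m) => (1 - ‖y‖ ^ 2) / a)
      ((-2 / a) • innerSL ℝ x) x := by
  have h := ((hasStrictFDerivAt_norm_sq x).hasFDerivAt.const_sub 1).mul_const a⁻¹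
  simp only [← div_eq_mul_inv] at h
  refine h.congr_fderiv ?_
  ext y
  simp
  ring

theorem pd_flatBump {m : ℕ} (a : ℝ) (i : Fin m) (x : EuclideanSpace ℝ (Fin m)) :
    pd i (flatBump a) x = (-2 / a) * x i *
      ((((1 - ‖x‖ ^ 2) / a)⁻¹) ^ 2 * expNegInvGlue ((1 - ‖x‖ ^ 2) / a)) := by
  have h := (expNegInvGlue_hasDerivAt _).comp_hasFDerivAt x (hasFDerivAt_one_sub_norm_sq_div a x)
  rw [show flatBump a = expNegInvGlue ∘ fun y : EuclideanSpace ℝ (Fin m) => (1 - ‖y‖ ^ 2) / a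
    from rfl, pd_eq_of_hasFDerivAt h]
  simp [EuclideanSpace.inner_single_right]
  ring

theorem pd_pd_flatBump {m : ℕ} (a : ℝ) (i j : Fin m) (x : EuclideanSpace ℝ (Fin m)) :
    pd i (pd j (flatBump a)) x =
      (-2 / a) ^ 2 * (x i * x j) * (((((1 - ‖x‖ ^ 2) / a)⁻¹) ^ 4 -
        2 * (((1 - ‖x‖ ^ 2) / a)⁻¹) ^ 3) * expNegInvGlue ((1 - ‖x‖ ^ 2) / a)) +
      (-2 / a) * (if i = j then 1 else 0) *
        ((((1 - ‖x‖ ^ 2) / a)⁻¹) ^ 2 * expNegInvGlue ((1 - ‖x‖ ^ 2) / a)) := by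
  have h := (expNegInvGlue_hasDerivAt_deriv _).comp_hasFDerivAt x
    (hasFDerivAt_one_sub_norm_sq_div a x)
  have hj : HasFDerivAt (fun y : EuclideanSpace ℝ (Fin m) => (-2 / a) * y j)
      ((-2 / a) • (EuclideanSpace.proj j : EuclideanSpace ℝ (Fin m) →L[ℝ] ℝ)) x :=
    (EuclideanSpace.proj j : EuclideanSpace ℝ (Fin m) →L[ℝ] ℝ).hasFDerivAt.const_mul _
  rw [show pd j (flatBump a) = _ from funext (pd_flatBump a j)]
  refine (pd_eq_of_hasFDerivAt (hj.mul h)).trans ?_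
  simp only [Function.comp_apply]
  generalize (1 - ‖x‖ ^ 2) / a = s
  simp [EuclideanSpace.inner_single_right, eq_comm (a := j)]
  split_ifs <;> ring

theorem euclLap_flatBump {m : ℕ} (a : ℝ) (x : EuclideanSpace ℝ (Fin m)) :
    euclLap (flatBump a) x =
      (-2 / a) ^ 2 * ‖x‖ ^ 2 * (((((1 - ‖x‖ ^ 2) / a)⁻¹) ^ 4 -
        2 * (((1 - ‖x‖ ^ 2) / a)⁻¹) ^ 3) * expNegInvGlue ((1 - ‖x‖ ^ 2) / a)) +
      (-2 / a) * m *
        ((((1 - ‖x‖ ^ 2) / a)⁻¹) ^ 2 * expNegInvGlue ((1 - ‖x‖ ^ 2) / a)) := by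
  simp only [euclLap, pd_pd_flatBump, if_true, sum_add_distrib, ← sum_mul, ← mul_sum,
    EuclideanSpace.real_norm_sq_eq x, sum_const, card_univ, Fintype.card_fin, nsmul_eq_mul, ← sq]
  ring

theorem gradNorm_le {m : ℕ} {u : EuclideanSpace ℝ (Fin m) → ℝ} {x : EuclideanSpace ℝ (Fin m)}
    {M : ℝ} (hM : 0 ≤ M) (h : ∀ i, |pd i u x| ≤ M) : gradNorm u x ≤ m * M := by
  refine Real.sqrt_le_iff.2 ⟨by positivity, ?_⟩
  calc ∑ i, pd i u x ^ 2 ≤ ∑ _i : Fin m, M ^ 2 := sum_le_sum fun i _ => by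
        rw [← sq_abs]; gcongr; exact h i
    _ = m * M ^ 2 := by simp
    _ ≤ (m * M) ^ 2 := by
        rw [mul_pow]; gcongr; exact_mod_cast Nat.le_self_pow two_ne_zero m

theorem hessNorm_le {m : ℕ} {u : EuclideanSpace ℝ (Fin m) → ℝ} {x : EuclideanSpace ℝ (Fin m)}
    {M : ℝ} (hM : 0 ≤ M) (h : ∀ i j, |pd i (pd j u) x| ≤ M) : hessNorm u x ≤ m * M := by
  refine Real.sqrt_le_iff.2 ⟨by positivity, ?_⟩
  calc ∑ i, ∑ j, pd i (pd j u) x ^ 2 ≤ ∑ _i : Fin m, ∑ _j : Fin m, M ^ 2 :=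
        sum_le_sum fun i _ => sum_le_sum fun j _ => by
          rw [← sq_abs]; gcongr; exact h i j
    _ = (m * M) ^ 2 := by simp; ring

theorem contDiff_flatBump {m : ℕ} (a : ℝ) :
    ContDiff ℝ (⊤ : ℕ∞) (flatBump a : EuclideanSpace ℝ (Fin m) → ℝ) :=
  expNegInvGlue.contDiff.comp ((contDiff_const.sub (contDiff_norm_sq ℝ)).div_const a)

theorem flatBump_annulus_estimate {m : ℕ} {x : EuclideanSpace ℝ (Fin m)}
    (hx : 1 / 2 < ‖x‖) (hx1 : ‖x‖ < 1) :
    |flatBump (4 + 4 * m) x| + gradNorm (flatBump (4 + 4 * m)) x +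
        hessNorm (flatBump (4 + 4 * m)) x ≤
      (2 * (4 + 4 * m) ^ 2 * (1 + 3 * m)) * euclLap (flatBump (4 + 4 * m)) x := by
  have hm : (0 : ℝ) ≤ m := m.cast_nonneg
  obtain ⟨a, ha⟩ : ∃ a : ℝ, a = 4 + 4 * m := ⟨_, rfl⟩
  rw [← ha]
  have ha4 : 4 ≤ a := by linarith
  have ha0 : 0 < a := by linarith
  have hr : 1 / 4 < ‖x‖ ^ 2 := by nlinarith
  have hr1 : ‖x‖ ^ 2 < 1 := by nlinarith
  obtain ⟨u, hu⟩ : ∃ u : ℝ, u = ((1 - ‖x‖ ^ 2) / a)⁻¹ := ⟨_, rfl⟩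
  obtain ⟨f, hf⟩ : ∃ f : ℝ, f = expNegInvGlue ((1 - ‖x‖ ^ 2) / a) := ⟨_, rfl⟩
  have hau : a ≤ u := by
    rw [hu, inv_div, le_div_iff₀ (by linarith)]
    nlinarith
  have hu0 : 0 < u := by linarith
  have hf0 : 0 ≤ f := hf ▸ expNegInvGlue.nonneg _
  have hcoord (i : Fin m) : |x i| ≤ 1 := (PiLp.norm_apply_le x i).trans hx1.le
  have hM : 0 ≤ u ^ 4 * f := by positivity
  have hu2 : 1 ≤ u ^ 2 := by nlinarith
  have hu24 : u ^ 2 ≤ u ^ 4 := by nlinarith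
  have ha2 : |-2 / a| ≤ 1 := by
    rw [abs_div, abs_of_pos ha0, div_le_one ha0]
    norm_num
    linarith
  have hval : |flatBump a x| ≤ u ^ 4 * f := by
    rw [flatBump, ← hf, abs_of_nonneg hf0]
    exact le_mul_of_one_le_left hf0 (hu2.trans hu24)
  have hgrad (i : Fin m) : |pd i (flatBump a) x| ≤ u ^ 4 * f := by
    rw [pd_flatBump, ← hf, ← hu, abs_mul, abs_mul, abs_of_nonneg (by positivity : 0 ≤ u ^ 2 * f)]
    calc |-2 / a| * |x i| * (u ^ 2 * f) ≤ 1 * 1 * (u ^ 4 * f) := by gcongr; exact hcoord i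
      _ = _ := by ring
  have hsecond : 0 ≤ u ^ 4 - 2 * u ^ 3 := by
    have : 0 ≤ u ^ 3 * (u - 2) := mul_nonneg (by positivity) (by linarith)
    linarith
  have hhess (i j : Fin m) : |pd i (pd j (flatBump a)) x| ≤ 2 * (u ^ 4 * f) := by
    rw [pd_pd_flatBump, ← hf, ← hu]
    refine (abs_add_le _ _).trans ?_
    simp only [abs_mul, abs_pow, abs_of_nonneg hf0, abs_of_nonneg hsecond]
    have hδ : |if i = j then (1 : ℝ) else 0| ≤ 1 := by split_ifs <;> simp
    rw [abs_of_pos hu0]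
    calc |-2 / a| ^ 2 * (|x i| * |x j|) * ((u ^ 4 - 2 * u ^ 3) * f) +
          |-2 / a| * |if i = j then (1 : ℝ) else 0| * (u ^ 2 * f)
        ≤ 1 ^ 2 * (1 * 1) * (u ^ 4 * f) + 1 * 1 * (u ^ 4 * f) := by
          gcongr
          · exact hcoord i
          · exact hcoord j
          · exact sub_le_self _ (by positivity)
      _ = _ := by ring
  have hlap : u ^ 4 * f ≤ 2 * a ^ 2 * euclLap (flatBump a) x := by
    have hexpand : 2 * a ^ 2 * euclLap (flatBump a) x =
        (8 * ‖x‖ ^ 2 * (u ^ 4 - 2 * u ^ 3) - a * (a - 4) * u ^ 2) * f := by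
      rw [euclLap_flatBump, ← hf, ← hu, show (m : ℝ) = (a - 4) / 4 by linarith]
      field_simp
      ring
    rw [hexpand]
    refine mul_le_mul_of_nonneg_right ?_ hf0
    have hr2 : 2 * (u ^ 4 - 2 * u ^ 3) ≤ 8 * ‖x‖ ^ 2 * (u ^ 4 - 2 * u ^ 3) :=
      mul_le_mul_of_nonneg_right (by linarith) hsecond
    have hq : 0 ≤ u ^ 2 * (u ^ 2 - 4 * u - a * (a - 4)) :=
      mul_nonneg (by positivity) (by nlinarith)
    linarith
  calc |flatBump a x| + gradNorm (flatBump a) x + hessNorm (flatBump a) x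
      ≤ u ^ 4 * f + m * (u ^ 4 * f) + m * (2 * (u ^ 4 * f)) := by
        gcongr
        · exact gradNorm_le hM hgrad
        · exact hessNorm_le (by positivity) hhess
    _ = (1 + 3 * m) * (u ^ 4 * f) := by ring
    _ ≤ (1 + 3 * m) * (2 * a ^ 2 * euclLap (flatBump a) x) := by gcongr
    _ = _ := by ring

/-- existence of a radial bump whose value, gradient and Hessian are
controlled by its Laplacian on the outer annulus. -/
theorem stmt7 (n : ℕ) (hn : 3 ≤ n) :
    ∃ (ρ : EuclideanSpace ℝ (Fin (n - 1)) → ℝ) (c : ℝ),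
      ContDiff ℝ (⊤ : ℕ∞) ρ ∧ 0 < c ∧
      (∀ x : EuclideanSpace ℝ (Fin (n - 1)), 1 ≤ ‖x‖ → ρ x = 0) ∧
      (∀ x : EuclideanSpace ℝ (Fin (n - 1)), ‖x‖ < 1 → 0 < ρ x) ∧
      (∀ x : EuclideanSpace ℝ (Fin (n - 1)), 1 / 2 < ‖x‖ → ‖x‖ < 1 →
        |ρ x| + gradNorm ρ x + hessNorm ρ x ≤ c * euclLap ρ x) := by
  have ha : (0 : ℝ) < 4 + 4 * (n - 1 : ℕ) := by positivity
  refine ⟨flatBump (4 + 4 * (n - 1 : ℕ)), _, contDiff_flatBump _, ?_, fun x hx => ?_,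
    fun x hx => ?_, fun x hx hx1 => flatBump_annulus_estimate hx hx1⟩
  · positivity
  · exact expNegInvGlue.zero_of_nonpos (div_nonpos_of_nonpos_of_nonneg (by nlinarith) ha.le)
  · exact expNegInvGlue.pos_of_pos (div_pos (by nlinarith [norm_nonneg x]) ha)
end
end

section
/- Let n ≥ 3 be an integer, let x₀ ∈ ∂ℝ^n_+, and let U be a relatively open subset of ℝ^n_+ containing x₀. Then there exists a smooth function ψ : ℝ^n_+ → ℝ such that ψ ≥ 0, ψ has compact support contained in U, Δψ(x) ≥ 0 for every x ∈ ℝ^n_+, and Δψ(x₁) > 0 for some x₁ ∈ ℝ^n_+, where Δ denotes the Euclidean Laplacian. -/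
open MeasureTheory Real Filter Topology Finset

noncomputable section

theorem hasDerivAt_expNegInvGlue (t : ℝ) :
    HasDerivAt expNegInvGlue ((t⁻¹) ^ 2 * expNegInvGlue t) t := by
  simpa using expNegInvGlue.hasDerivAt_polynomial_eval_inv_mul (1 : Polynomial ℝ) t

theorem hasDerivAt_inv_sq_mul_expNegInvGlue (t : ℝ) :
    HasDerivAt (fun t : ℝ => (t⁻¹) ^ 2 * expNegInvGlue t)
      ((t⁻¹) ^ 2 * ((t⁻¹) ^ 2 - 2 * t⁻¹) * expNegInvGlue t) t := by
  have h := expNegInvGlue.hasDerivAt_polynomial_eval_inv_mul (Polynomial.X ^ 2) t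
  simpa only [Polynomial.eval_mul, Polynomial.eval_sub, Polynomial.eval_pow, Polynomial.eval_X,
    Polynomial.derivative_X_sq, Polynomial.eval_C] using h

theorem HasFDerivAt.pd_eq {n : ℕ} {i : Fin n} {f : EuclideanSpace ℝ (Fin n) → ℝ}
    {f' : EuclideanSpace ℝ (Fin n) →L[ℝ] ℝ} {x : EuclideanSpace ℝ (Fin n)}
    (h : HasFDerivAt f f' x) : pd i f x = f' (EuclideanSpace.single i 1) := by
  rw [pd, h.fderiv]

/-- The defining function `ε + 1 - ‖x - c‖²` of the ball of squared radius `ε + 1` whose centre `c`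
lies one unit below the boundary point `x₀`. -/
def capFun {n : ℕ} (iN : Fin n) (x₀ : EuclideanSpace ℝ (Fin n)) (ε : ℝ)
    (x : EuclideanSpace ℝ (Fin n)) : ℝ :=
  ε - ‖x - x₀‖ ^ 2 - 2 * x iN

theorem hasFDerivAt_capFun {n : ℕ} (iN : Fin n) (x₀ : EuclideanSpace ℝ (Fin n)) (ε : ℝ)
    (x : EuclideanSpace ℝ (Fin n)) :
    HasFDerivAt (capFun iN x₀ ε)
      (-((2 : ℝ) • innerSL ℝ (x - x₀)) - (2 : ℝ) • (EuclideanSpace.proj iN : EuclideanSpace ℝ (Fin n) →L[ℝ] ℝ)) x := by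
  have h₁ := ((hasFDerivAt_id x).sub_const x₀).norm_sq
  have h₂ := (EuclideanSpace.proj iN : EuclideanSpace ℝ (Fin n) →L[ℝ] ℝ).hasFDerivAt (x := x)
  have h := (h₁.const_sub ε).sub (h₂.const_mul 2)
  refine h.congr_fderiv ?_
  ext v
  simp

theorem contDiff_capFun {n : ℕ} (iN : Fin n) (x₀ : EuclideanSpace ℝ (Fin n)) (ε : ℝ) :
    ContDiff ℝ (⊤ : ℕ∞) (capFun iN x₀ ε) := by
  have h := (EuclideanSpace.proj iN : EuclideanSpace ℝ (Fin n) →L[ℝ] ℝ).contDiff (n := (⊤ : ℕ∞))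
  exact (contDiff_const.sub ((contDiff_id.sub contDiff_const).norm_sq ℝ)).sub
    (contDiff_const.mul h)

theorem HasDerivAt.pd_comp_capFun {n : ℕ} {iN : Fin n} {x₀ : EuclideanSpace ℝ (Fin n)} {ε : ℝ}
    {g : ℝ → ℝ} {g' : ℝ} {x : EuclideanSpace ℝ (Fin n)} (i : Fin n)
    (hg : HasDerivAt g g' (capFun iN x₀ ε x)) :
    pd i (fun y => g (capFun iN x₀ ε y)) x =
      g' * (-2 * (x i - x₀ i) - 2 * (if iN = i then 1 else 0)) := by
  refine (HasFDerivAt.pd_eq (hg.comp_hasFDerivAt x (hasFDerivAt_capFun iN x₀ ε x))).trans ?_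
  simp [EuclideanSpace.inner_single_right]

theorem pd_pd_comp_capFun {n : ℕ} {iN : Fin n} {x₀ : EuclideanSpace ℝ (Fin n)} {ε : ℝ}
    {g g' : ℝ → ℝ} {g'' : ℝ} {x : EuclideanSpace ℝ (Fin n)} (i : Fin n)
    (hg : ∀ t, HasDerivAt g (g' t) t) (hg' : HasDerivAt g' g'' (capFun iN x₀ ε x)) :
    pd i (pd i fun y => g (capFun iN x₀ ε y)) x =
      g'' * (-2 * (x i - x₀ i) - 2 * (if iN = i then 1 else 0)) ^ 2 -
        2 * g' (capFun iN x₀ ε x) := by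
  have hpd : pd i (fun y => g (capFun iN x₀ ε y)) = fun y =>
      g' (capFun iN x₀ ε y) * (-2 * (y i - x₀ i) - 2 * (if iN = i then 1 else 0)) :=
    funext fun y => (hg _).pd_comp_capFun i
  have h₁ := hg'.comp_hasFDerivAt x (hasFDerivAt_capFun iN x₀ ε x)
  have h₂ := (EuclideanSpace.proj i : EuclideanSpace ℝ (Fin n) →L[ℝ] ℝ).hasFDerivAt (x := x)
  have h₃ := ((h₂.sub_const (x₀ i)).const_mul (-2)).sub_const (2 * (if iN = i then 1 else 0))
  rw [hpd]
  refine (HasFDerivAt.pd_eq (h₁.mul h₃)).trans ?_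
  simp [EuclideanSpace.inner_single_right]
  split_ifs <;> ring

theorem euclLap_comp_capFun {n : ℕ} {iN : Fin n} {x₀ : EuclideanSpace ℝ (Fin n)} {ε : ℝ}
    {g g' : ℝ → ℝ} {g'' : ℝ} {x : EuclideanSpace ℝ (Fin n)}
    (hg : ∀ t, HasDerivAt g (g' t) t) (hg' : HasDerivAt g' g'' (capFun iN x₀ ε x)) :
    euclLap (fun y => g (capFun iN x₀ ε y)) x =
      4 * g'' * (‖x - x₀‖ ^ 2 + 2 * (x iN - x₀ iN) + 1) - 2 * n * g' (capFun iN x₀ ε x) := by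
  have hterm (i : Fin n) : pd i (pd i fun y => g (capFun iN x₀ ε y)) x =
      4 * g'' * (x i - x₀ i) ^ 2 + (if i = iN then 8 * g'' * (x i - x₀ i) + 4 * g'' else 0) -
        2 * g' (capFun iN x₀ ε x) := by
    rw [pd_pd_comp_capFun i hg hg']
    by_cases h : i = iN
    · subst h; simp; ring
    · simp [h, Ne.symm h]; ring
  rw [euclLap, Finset.sum_congr rfl fun i _ => hterm i, Finset.sum_sub_distrib,
    Finset.sum_add_distrib, ← Finset.mul_sum, EuclideanSpace.real_norm_sq_eq]
  simp
  ring

/-- The Laplacian of the exponential bump is positive where the bump is. -/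
theorem euclLap_expNegInvGlue_capFun {n : ℕ} {iN : Fin n} {x₀ : EuclideanSpace ℝ (Fin n)} {ε : ℝ}
    (hx₀ : x₀ ∈ bdry iN) (hε : 4 * n * ε ≤ 1) (hε' : 4 * ε ≤ 1)
    {x : EuclideanSpace ℝ (Fin n)} (hx : x ∈ halfSpace iN) (ht : 0 < capFun iN x₀ ε x) :
    0 < euclLap (fun y => expNegInvGlue (capFun iN x₀ ε y)) x := by
  rw [euclLap_comp_capFun hasDerivAt_expNegInvGlue (hasDerivAt_inv_sq_mul_expNegInvGlue _)]
  have h₀ : x₀ iN = 0 := hx₀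
  have hx' : 0 ≤ x iN := hx
  have hN := sq_nonneg ‖x - x₀‖
  have htε : capFun iN x₀ ε x ≤ ε := by unfold capFun; linarith
  set t := capFun iN x₀ ε x
  set ρ := ‖x - x₀‖ ^ 2 + 2 * (x iN - x₀ iN) + 1
  have hρ : 1 ≤ ρ := by simp only [ρ, h₀]; linarith
  have hG : 0 < expNegInvGlue t := expNegInvGlue.pos_of_pos ht
  have hnt : (n : ℝ) * t ≤ 1 / 4 := by
    have := mul_le_mul_of_nonneg_left htε (Nat.cast_nonneg (α := ℝ) n)
    linarith
  have hkey : 0 < 4 * (1 - 2 * t) * ρ - 2 * n * t ^ 2 := by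
    nlinarith [mul_le_mul_of_nonneg_right hnt ht.le]
  have heq : 4 * (t⁻¹ ^ 2 * (t⁻¹ ^ 2 - 2 * t⁻¹) * expNegInvGlue t) * ρ -
      2 * n * (t⁻¹ ^ 2 * expNegInvGlue t) =
      expNegInvGlue t / t ^ 4 * (4 * (1 - 2 * t) * ρ - 2 * n * t ^ 2) := by
    field_simp
  rw [heq]
  positivity

/-- existence of a compactly supported nonnegative subharmonic bump
near a boundary point of the half-space. -/
theorem stmt9 (n : ℕ) (hn : 3 ≤ n) (iN : Fin n) (hiN : (iN : ℕ) = n - 1)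
    (x₀ : EuclideanSpace ℝ (Fin n)) (hx₀ : x₀ ∈ bdry iN)
    (U : Set (EuclideanSpace ℝ (Fin n)))
    (hU : ∃ V : Set (EuclideanSpace ℝ (Fin n)), IsOpen V ∧ U = V ∩ halfSpace iN)
    (hx₀U : x₀ ∈ U) :
    ∃ ψ : EuclideanSpace ℝ (Fin n) → ℝ,
      ContDiffOn ℝ (⊤ : ℕ∞) ψ (halfSpace iN) ∧
      (∀ x ∈ halfSpace iN, 0 ≤ ψ x) ∧
      (∃ K : Set (EuclideanSpace ℝ (Fin n)), IsCompact K ∧ K ⊆ U ∧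
        ∀ x ∈ halfSpace iN, x ∉ K → ψ x = 0) ∧
      (∀ x ∈ halfSpace iN, 0 ≤ euclLap ψ x) ∧
      ∃ x₁ ∈ halfSpace iN, 0 < euclLap ψ x₁ := by
  obtain ⟨V, hV, rfl⟩ := hU
  obtain ⟨δ, hδ, hball⟩ := Metric.isOpen_iff.1 hV x₀ hx₀U.1
  have hn0 : (0 : ℝ) < n := by positivity
  have hn1 : (3 : ℝ) ≤ n := by exact_mod_cast hn
  set ε : ℝ := min (δ ^ 2 / 2) (1 / (4 * n)) with hεdef
  have hε0 : 0 < ε := lt_min (by positivity) (by positivity)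
  have hεδ : ε < δ ^ 2 := (min_le_left _ _).trans_lt (by nlinarith [pow_pos hδ 2])
  have hεn : 4 * n * ε ≤ 1 := by
    have := min_le_right (δ ^ 2 / 2) (1 / (4 * (n : ℝ)))
    rwa [← hεdef, le_div_iff₀ (by positivity), mul_comm] at this
  have hε1 : 4 * ε ≤ 1 := by nlinarith
  have hcap : 0 < capFun iN x₀ ε x₀ := by
    have h₀ : x₀ iN = 0 := hx₀
    simpa [capFun, h₀] using hε0
  refine ⟨fun x => expNegInvGlue (capFun iN x₀ ε x),
    (expNegInvGlue.contDiff.comp (contDiff_capFun iN x₀ ε)).contDiffOn,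
    fun x _ => expNegInvGlue.nonneg _,
    ⟨Metric.closedBall x₀ (√ε) ∩ halfSpace iN, ?_, ?_, ?_⟩, ?_, x₀, hx₀U.2,
    euclLap_expNegInvGlue_capFun hx₀ hεn hε1 hx₀U.2 hcap⟩
  · refine (isCompact_closedBall _ _).inter_right (isClosed_le continuous_const ?_)
    exact (EuclideanSpace.proj iN : EuclideanSpace ℝ (Fin n) →L[ℝ] ℝ).continuous
  · refine Set.inter_subset_inter_left _ ((Metric.closedBall_subset_ball ?_).trans hball)
    exact (Real.sqrt_lt' hδ).2 hεδ
  · intro x hx hxK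
    refine expNegInvGlue.zero_of_nonpos ?_
    have hdist : √ε < ‖x - x₀‖ := by
      by_contra! h
      exact hxK ⟨mem_closedBall_iff_norm.2 h, hx⟩
    have hlt := (Real.sqrt_lt' ((Real.sqrt_nonneg _).trans_lt hdist)).1 hdist
    have hx' : 0 ≤ x iN := hx
    unfold capFun
    linarith
  · intro x hx
    rcases lt_or_ge 0 (capFun iN x₀ ε x) with ht | ht
    · exact (euclLap_expNegInvGlue_capFun hx₀ hεn hε1 hx ht).le
    · rw [euclLap_comp_capFun hasDerivAt_expNegInvGlue (hasDerivAt_inv_sq_mul_expNegInvGlue _),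
        expNegInvGlue.zero_of_nonpos ht]
      simp

end
end
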